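/- In GF(4) = GF(2)[x]/(x² + x + 1), set α = x and β = x². For any K ≠ 0 in GF(4), the code C = {(b,m,e) : α·b + m + β·e = K} detects all single, transposition, twin, jump transposition, jump twin, and cyclic errors, and contains no triple word. -/

import Mathlib

open Polynomial

/-- The argument over any commutative ring of characteristic two with a root of `x² + x + 1`. -/
theorem aux_code {R : Type*} [CommRing R] (α K : R) (h2 : (2 : R) = 0)
    (h : α ^ 2 + α + 1 = 0) (hK : K ≠ 0) :
    let β := α ^ 2
    (∀ b m e b' m' e', α * b + m + β * e = K → α * b' + m' + β * e' = K →
      ((b = b' ∧ m = m' → e = e') ∧ (b = b' ∧ e = e' → m = m') ∧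
       (m = m' ∧ e = e' → b = b'))) ∧
    (∀ a b c, α * a + b + β * c = K → α * b + a + β * c = K → a = b) ∧
    (∀ a b c, α * a + b + β * c = K → α * a + c + β * b = K → b = c) ∧
    (∀ a b c, α * a + a + β * c = K → α * b + b + β * c = K → a = b) ∧
    (∀ a b c, α * a + b + β * b = K → α * a + c + β * c = K → b = c) ∧
    (∀ a b c, α * a + b + β * c = K → α * c + b + β * a = K → a = c) ∧
    (∀ a b c, α * a + b + β * a = K → α * c + b + β * c = K → a = c) ∧
    (∀ a b c, α * a + b + β * c = K → α * b + c + β * a = K → a = b ∧ b = c) ∧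
    (∀ a, α * a + a + β * a ≠ K) := by
  intro β
  have hβ : β = α + 1 := by
    change α ^ 2 = α + 1
    linear_combination h - (α + 1) * h2
  have hα : α * (α + 1) = 1 := by linear_combination h - h2
  clear_value β
  subst hβ
  refine ⟨?_, ?_, ?_, ?_, ?_, ?_, ?_, ?_, ?_⟩
  · intro b m e b' m' e' h3 h4
    refine ⟨?_, ?_, ?_⟩
    · rintro ⟨rfl, rfl⟩
      linear_combination α * (h3 - h4) - (e - e') * hα
    · rintro ⟨rfl, rfl⟩
      linear_combination h3 - h4
    · rintro ⟨rfl, rfl⟩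
      linear_combination (α + 1) * (h3 - h4) - (b - b') * hα
  · intro a b c h3 h4; grind
  · intro a b c h3 h4; grind
  · intro a b c h3 h4; grind
  · intro a b c h3 h4; grind
  · intro a b c h3 h4; grind
  · intro a b c h3 h4; grind
  · intro a b c h3 h4
    exact absurd (by grind) hK
  · intro a h3
    exact hK (by grind)

/-- In GF(4) = GF(2)[x]/(x² + x + 1), with α = x and β = α², for any K ≠ 0 the
code α·b + m + β·e = K detects all single, transposition, twin, jump
transposition, jump twin and cyclic errors, and contains no triple word. -/
theorem stmt_13 (K : AdjoinRoot (X ^ 2 + X + C 1 : Polynomial (ZMod 2)))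
    (hK : K ≠ 0) :
    let α := AdjoinRoot.root (X ^ 2 + X + C 1 : Polynomial (ZMod 2))
    let β := α ^ 2
    -- single errors
    (∀ b m e b' m' e', α * b + m + β * e = K → α * b' + m' + β * e' = K →
      ((b = b' ∧ m = m' → e = e') ∧ (b = b' ∧ e = e' → m = m') ∧
       (m = m' ∧ e = e' → b = b'))) ∧
    -- adjacent transposition errors
    (∀ a b c, α * a + b + β * c = K → α * b + a + β * c = K → a = b) ∧
    (∀ a b c, α * a + b + β * c = K → α * a + c + β * b = K → b = c) ∧
    -- adjacent twin errors
    (∀ a b c, α * a + a + β * c = K → α * b + b + β * c = K → a = b) ∧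
    (∀ a b c, α * a + b + β * b = K → α * a + c + β * c = K → b = c) ∧
    -- jump transposition errors
    (∀ a b c, α * a + b + β * c = K → α * c + b + β * a = K → a = c) ∧
    -- jump twin errors
    (∀ a b c, α * a + b + β * a = K → α * c + b + β * c = K → a = c) ∧
    -- cyclic errors
    (∀ a b c, α * a + b + β * c = K → α * b + c + β * a = K → a = b ∧ b = c) ∧
    -- no triple word
    (∀ a, α * a + a + β * a ≠ K) := by
  refine aux_code _ K ?_ ?_ hK
  · have h := congrArg (AdjoinRoot.of (X ^ 2 + X + C 1 : Polynomial (ZMod 2)))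
      (show (2 : ZMod 2) = 0 by decide)
    simpa only [map_ofNat, map_zero] using h
  · have h := AdjoinRoot.eval₂_root (X ^ 2 + X + C 1 : Polynomial (ZMod 2))
    simpa only [eval₂_add, eval₂_pow, eval₂_X, eval₂_C, map_one, eval₂_one] using h
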